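/- Exponential density growth below the threshold rⁿ: let n ≥ 1, r > 0, Ω ⊆ ℝⁿ be open, and let E be a measurable set which is a minimizer of Per_r in every open ball contained in Ω. Let R_o > 0 with B_{R_o} ⊆ Ω and ω_o := Lⁿ(E ∩ B_{R_o}) > 0. Then for every C̄ > 0 there exists c̃ > 0, depending only on n and C̄, such that for every integer k ≥ 1 with B_{R_o + 2kr} ⊆ Ω and Lⁿ(E ∩ B_{R_o + 2(k−1)r}) ≤ C̄ rⁿ, one has Lⁿ(E ∩ B_{R_o + 2kr}) ≥ ω_o (1 + c̃)^k. -/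

import Mathlib

open MeasureTheory Metric Set Filter Topology
open scoped RealInnerProductSpace ENNReal

noncomputable section

/-- The set of points of Lebesgue density one of `E`. -/
def densityOnePoints (n : ℕ) (E : Set (EuclideanSpace ℝ (Fin n))) :
    Set (EuclideanSpace ℝ (Fin n)) :=
  {x | Tendsto (fun ρ : ℝ => volume (E ∩ ball x ρ) / volume (ball x ρ)) (𝓝[>] 0) (𝓝 1)}

/-- The `r`-perimeter `Per_r(E, Ω) = (1/(2r)) Lⁿ((∂E ⊕ B_r) ∩ Ω)`, where `E` is identified with
its points of density one, `∂E` is the topological boundary of that set, and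
`A ⊕ B_r` is the open `r`-neighbourhood of `A`. -/
def perR (n : ℕ) (r : ℝ) (E Ω : Set (EuclideanSpace ℝ (Fin n))) : ℝ≥0∞ :=
  volume (Metric.thickening r (frontier (densityOnePoints n E)) ∩ Ω) / ENNReal.ofReal (2 * r)

/-- The inner domain `D ⊖ B_r = {x ∈ D : dist(x, ∂D) ≥ r}`. -/
def innerDomain (n : ℕ) (r : ℝ) (D : Set (EuclideanSpace ℝ (Fin n))) :
    Set (EuclideanSpace ℝ (Fin n)) :=
  {x ∈ D | r ≤ Metric.infDist x (frontier D)}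

/-- `E` is a minimizer of `Per_r` in `D`: it minimizes among measurable competitors that
coincide with `E` outside `D ⊖ B_r`. -/
def IsMinimizerPerR (n : ℕ) (r : ℝ) (E D : Set (EuclideanSpace ℝ (Fin n))) : Prop :=
  ∀ F : Set (EuclideanSpace ℝ (Fin n)), MeasurableSet F →
    F \ innerDomain n r D = E \ innerDomain n r D → perR n r E D ≤ perR n r F D

lemma aux_conn {X : Type*} [TopologicalSpace X] {S A : Set X} (hS : IsPreconnected S)
    (hd : ∀ x ∈ S, x ∉ frontier A) (hne : (S ∩ A).Nonempty) : S ⊆ A := by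
  have hsub : S ⊆ interior A ∪ (closure A)ᶜ := by
    intro x hx
    by_cases h1 : x ∈ interior A
    · exact Or.inl h1
    · right
      intro h2
      exact hd x hx ⟨h2, h1⟩
  have hdis : Disjoint (interior A) (closure A)ᶜ := by
    rw [Set.disjoint_left]
    intro x hx hx'
    exact hx' (subset_closure (interior_subset hx))
  refine (hS.subset_left_of_subset_union isOpen_interior isClosed_closure.isOpen_compl hdis hsub
    ?_).trans interior_subset
  obtain ⟨x, hx, hxA⟩ := hne
  refine ⟨x, hx, ?_⟩
  by_contra h
  exact hd x hx ⟨subset_closure hxA, h⟩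

lemma dens_mono {n : ℕ} {E F : Set (EuclideanSpace ℝ (Fin n))} (h : F ⊆ E) :
    densityOnePoints n F ⊆ densityOnePoints n E := by
  intro x hx
  refine tendsto_of_tendsto_of_tendsto_of_le_of_le (show Tendsto _ _ _ from hx)
    tendsto_const_nhds ?_ ?_
  · intro ρ
    exact ENNReal.div_le_div_right (measure_mono (inter_subset_inter_left _ h)) _
  · intro ρ
    exact ENNReal.div_le_of_le_mul (by simpa using measure_mono inter_subset_right)

lemma dens_local {n : ℕ} {E F U : Set (EuclideanSpace ℝ (Fin n))} (hU : IsOpen U)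
    (h : E ∩ U ⊆ F) : densityOnePoints n E ∩ U ⊆ densityOnePoints n F := by
  rintro x ⟨hx, hxU⟩
  obtain ⟨ε, hε, hb⟩ := Metric.isOpen_iff.1 hU x hxU
  have : x ∈ densityOnePoints n (E ∩ U) := by
    refine Tendsto.congr' ?_ (show Tendsto _ _ _ from hx)
    filter_upwards [Ioo_mem_nhdsGT hε] with ρ hρ
    have h1 : ball x ρ ⊆ U := (ball_subset_ball hρ.2.le).trans hb
    rw [inter_assoc, inter_eq_right.2 h1]
  exact dens_mono h this

lemma dens_empty {n : ℕ} : densityOnePoints n ∅ = ∅ := by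
  ext x
  simp [densityOnePoints]

lemma dens_ae {n : ℕ} {E : Set (EuclideanSpace ℝ (Fin n))} (hE : MeasurableSet E) :
    densityOnePoints n E =ᵐ[volume] E := by
  rw [Filter.eventuallyEq_set]
  filter_upwards [Besicovitch.ae_tendsto_measure_inter_div_of_measurableSet volume hE] with x hx
  have hx' : Tendsto (fun ρ : ℝ => volume (E ∩ ball x ρ) / volume (ball x ρ)) (𝓝[>] 0)
      (𝓝 (E.indicator 1 x)) := by
    refine hx.congr' ?_
    filter_upwards [self_mem_nhdsWithin] with ρ hρ
    have hae : (closedBall x ρ : Set (EuclideanSpace ℝ (Fin n))) =ᵐ[volume] ball x ρ := by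
      have h0 := Measure.addHaar_sphere_of_ne_zero
        (volume : Measure (EuclideanSpace ℝ (Fin n))) x (ne_of_gt hρ)
      rw [← ball_union_sphere]
      exact union_ae_eq_left_of_ae_eq_empty (ae_eq_empty.2 h0)
    rw [measure_congr hae, measure_congr ((ae_eq_refl E).inter hae)]
  constructor
  · intro h
    by_contra hxE
    have := tendsto_nhds_unique (show Tendsto _ _ _ from h) hx'
    simp [hxE] at this
  · intro h
    have h2 : E.indicator (1 : EuclideanSpace ℝ (Fin n) → ℝ≥0∞) x = 1 := by simp [h]
    rw [h2] at hx'
    exact hx'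

lemma exists_dir {n : ℕ} (hn : 1 ≤ n) (x : EuclideanSpace ℝ (Fin n)) :
    ∃ e : EuclideanSpace ℝ (Fin n), ‖e‖ = 1 ∧ ∀ t : ℝ, 0 ≤ t → ‖x + t • e‖ = ‖x‖ + t := by
  by_cases hx : x = 0
  · refine ⟨EuclideanSpace.single ⟨0, hn⟩ 1, by simp, ?_⟩
    intro t ht
    simp [hx, norm_smul, abs_of_nonneg ht]
  · have hx' : ‖x‖ ≠ 0 := norm_ne_zero_iff.2 hx
    refine ⟨‖x‖⁻¹ • x, by simp [norm_smul, hx'], ?_⟩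
    intro t ht
    have : x + t • ‖x‖⁻¹ • x = (1 + t * ‖x‖⁻¹) • x := by
      rw [add_smul, one_smul, smul_smul]
    rw [this, norm_smul, Real.norm_of_nonneg (by positivity)]
    field_simp

/-- The energy comparison. -/
lemma energy {n : ℕ} (hn : 1 ≤ n) {r R : ℝ} (hr : 0 < r) (hR : 0 < R)
    {E : Set (EuclideanSpace ℝ (Fin n))} (hE : MeasurableSet E)
    (hmin : IsMinimizerPerR n r E (ball 0 (R + 2 * r))) :
    volume (thickening r (frontier (densityOnePoints n E)) ∩ ball 0 R) ≤
      volume (densityOnePoints n E ∩ (ball 0 (R + 2 * r) \ ball 0 R)) := by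
  set A := densityOnePoints n E with hA
  set F := E \ closedBall 0 (R + r) with hF
  set A' := densityOnePoints n F with hA'
  have hFm : MeasurableSet F := hE.diff measurableSet_closedBall
  have hinner : closedBall 0 (R + r) ⊆ innerDomain n r (ball 0 (R + 2 * r)) := by
    intro x hx
    rw [mem_closedBall_zero_iff] at hx
    refine ⟨by rw [mem_ball_zero_iff]; linarith, ?_⟩
    rw [frontier_ball _ (by positivity)]
    have hne : (sphere (0 : EuclideanSpace ℝ (Fin n)) (R + 2 * r)).Nonempty := by
      obtain ⟨e, he, _⟩ := exists_dir hn (0 : EuclideanSpace ℝ (Fin n))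
      refine ⟨(R + 2 * r) • e, ?_⟩
      rw [mem_sphere_zero_iff_norm, norm_smul, he, Real.norm_of_nonneg (by positivity), mul_one]
    rw [le_infDist hne]
    intro y hy
    rw [mem_sphere_zero_iff_norm] at hy
    have := norm_sub_norm_le y x
    rw [dist_comm, dist_eq_norm]
    linarith
  have hper := hmin F hFm (by
    rw [hF, sdiff_sdiff, union_eq_right.2 hinner])
  have h2r : (0 : ℝ) < 2 * r := by positivity
  have hvol : volume (thickening r (frontier A) ∩ ball 0 (R + 2 * r)) ≤
      volume (thickening r (frontier A') ∩ ball 0 (R + 2 * r)) := by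
    unfold perR at hper
    have h1 : ENNReal.ofReal (2 * r) ≠ 0 := (ENNReal.ofReal_pos.2 h2r).ne'
    have h2 := mul_le_mul_left hper (ENNReal.ofReal (2 * r))
    rwa [ENNReal.div_mul_cancel h1 ENNReal.ofReal_ne_top,
      ENNReal.div_mul_cancel h1 ENNReal.ofReal_ne_top] at h2
  have hA'A : A' ⊆ A := dens_mono sdiff_subset
  have hA'ball : A' ∩ ball 0 (R + r) = ∅ := by
    rw [← subset_empty_iff, ← dens_empty (n := n)]
    refine dens_local isOpen_ball ?_
    rintro x ⟨hx, hx'⟩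
    exact (hx.2 (ball_subset_closedBall hx')).elim
  have hloc : A' ∩ (closedBall 0 (R + r))ᶜ = A ∩ (closedBall 0 (R + r))ᶜ := by
    apply Subset.antisymm
    · exact inter_subset_inter_left _ hA'A
    · refine subset_inter (dens_local isClosed_closedBall.isOpen_compl ?_) inter_subset_right
      rintro x ⟨hx, hx'⟩
      exact ⟨hx, hx'⟩
  have hfr1 : ∀ y ∈ frontier A', R + r ≤ ‖y‖ := by
    intro y hy
    by_contra! h
    obtain ⟨z, hz, hz'⟩ := mem_closure_iff.1 hy.1 (ball 0 (R + r)) isOpen_ball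
      (mem_ball_zero_iff.2 h)
    have : z ∈ A' ∩ ball 0 (R + r) := ⟨hz', hz⟩
    rw [hA'ball] at this
    exact this
  have hfr2 : ∀ y ∈ frontier A', R + r < ‖y‖ → y ∈ frontier A := by
    intro y hy hlt
    have hy' : y ∈ frontier A' ∩ (closedBall 0 (R + r))ᶜ := ⟨hy, by simpa using hlt⟩
    rw [← frontier_inter_open_inter isClosed_closedBall.isOpen_compl, hloc,
      frontier_inter_open_inter isClosed_closedBall.isOpen_compl] at hy'
    exact hy'.1
  have hsub : thickening r (frontier A') ∩ ball 0 (R + 2 * r) ⊆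
      ((thickening r (frontier A) ∩ ball 0 (R + 2 * r)) \ ball 0 R) ∪
      (A ∩ (ball 0 (R + 2 * r) \ ball 0 R)) := by
    rintro x ⟨hx, hxD⟩
    obtain ⟨y, hy, hxy⟩ := mem_thickening_iff.1 hx
    have hy1 := hfr1 y hy
    have hxR : x ∉ ball (0 : EuclideanSpace ℝ (Fin n)) R := by
      rw [mem_ball_zero_iff]
      have := norm_sub_norm_le y x
      rw [dist_comm, dist_eq_norm] at hxy
      linarith
    by_cases hxT : x ∈ thickening r (frontier A)
    · exact Or.inl ⟨⟨hxT, hxD⟩, hxR⟩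
    · right
      refine ⟨?_, hxD, hxR⟩
      have hdis : ∀ z ∈ ball x r, z ∉ frontier A := by
        intro z hz hzA
        exact hxT (mem_thickening_iff.2 ⟨z, hzA, by rwa [dist_comm]⟩)
      have hsubA : ball x r ⊆ A := by
        refine aux_conn (convex_ball x r).isPreconnected hdis ?_
        exact mem_closure_iff.1 (closure_mono hA'A hy.1) _ isOpen_ball
          (by rw [mem_ball, dist_comm]; exact hxy)
      exact hsubA (mem_ball_self hr)
  have hsplit := measure_inter_add_sdiff
    (μ := (volume : Measure (EuclideanSpace ℝ (Fin n))))
    (thickening r (frontier A) ∩ ball 0 (R + 2 * r)) (measurableSet_ball (x := 0) (ε := R))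
  have hball : ball (0 : EuclideanSpace ℝ (Fin n)) R ⊆ ball 0 (R + 2 * r) :=
    ball_subset_ball (by linarith)
  rw [inter_assoc, inter_eq_right.2 hball] at hsplit
  have hfin : volume ((thickening r (frontier A) ∩ ball 0 (R + 2 * r)) \ ball 0 R) ≠ ⊤ :=
    (lt_of_le_of_lt (measure_mono (sdiff_subset.trans inter_subset_right)) measure_ball_lt_top).ne
  have hfinal := hvol.trans ((measure_mono hsub).trans (measure_union_le _ _))
  rw [← hsplit, add_comm] at hfinal
  exact (ENNReal.add_le_add_iff_left hfin).1 hfinal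

lemma ball_shift {n : ℕ} {x y : EuclideanSpace ℝ (Fin n)} {a b : ℝ} (h : dist x y + a ≤ b) :
    ball x a ⊆ ball y b := ball_subset_ball' (by linarith)

/-- Either all of `A ∩ B_R` is near the boundary, or a ball of radius `r/4` is gained. -/
lemma geom {n : ℕ} (hn : 1 ≤ n) {r R : ℝ} (hr : 0 < r)
    (A : Set (EuclideanSpace ℝ (Fin n))) :
    A ∩ ball 0 R ⊆ thickening r (frontier A) ∩ ball 0 R ∨
    (∃ z, ball z (r / 4) ⊆ thickening r (frontier A) ∩ ball 0 R) ∨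
    (∃ z, ball z (r / 4) ⊆ A ∩ (ball 0 (R + 2 * r) \ ball 0 R)) := by
  by_cases hall : A ∩ ball 0 R ⊆ thickening r (frontier A)
  · exact Or.inl (subset_inter hall inter_subset_right)
  right
  obtain ⟨x0, ⟨hx0A, hx0R⟩, hx0T⟩ := not_subset.1 hall
  rw [mem_ball_zero_iff] at hx0R
  have key : ∀ x : EuclideanSpace ℝ (Fin n), x ∈ A → x ∉ thickening r (frontier A) →
      R - r / 2 ≤ ‖x‖ → ‖x‖ < R →
      ∃ z, ball z (r / 4) ⊆ A ∩ (ball 0 (R + 2 * r) \ ball 0 R) := by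
    intro x hxA hxT h1 h2
    obtain ⟨e, he, het⟩ := exists_dir hn x
    have hzn := het (3 / 4 * r) (by positivity)
    refine ⟨x + (3 / 4 * r) • e, ?_⟩
    have hsubA : ball x r ⊆ A := by
      refine aux_conn (convex_ball x r).isPreconnected ?_ ⟨x, mem_ball_self hr, hxA⟩
      intro z hz hzA
      exact hxT (mem_thickening_iff.2 ⟨z, hzA, by rwa [dist_comm]⟩)
    have hd : dist (x + (3 / 4 * r) • e) x = 3 / 4 * r := by
      rw [dist_eq_norm, add_sub_cancel_left, norm_smul, he, Real.norm_of_nonneg (by positivity),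
        mul_one]
    refine subset_inter ((ball_shift (by rw [hd]; linarith)).trans hsubA) ?_
    intro w hw
    rw [mem_ball, dist_eq_norm] at hw
    have ha := norm_sub_norm_le w (x + (3 / 4 * r) • e)
    have hb := norm_sub_norm_le (x + (3 / 4 * r) • e) w
    rw [norm_sub_rev] at hb
    refine ⟨by rw [mem_ball_zero_iff]; linarith, by rw [mem_ball_zero_iff]; linarith⟩
  rcases le_or_gt (R - r / 2) ‖x0‖ with h | h
  · exact Or.inr (key x0 hx0A hx0T h hx0R)
  have hpre : IsPreconnected (closedBall (0 : EuclideanSpace ℝ (Fin n)) (R - r / 2)) :=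
    (convex_closedBall _ _).isPreconnected
  have hx0B : x0 ∈ closedBall (0 : EuclideanSpace ℝ (Fin n)) (R - r / 2) := by
    rw [mem_closedBall_zero_iff]; exact h.le
  by_cases hT : ∀ x ∈ closedBall (0 : EuclideanSpace ℝ (Fin n)) (R - r / 2),
      x ∉ thickening r (frontier A)
  · right
    have hsub : closedBall 0 (R - r / 2) ⊆ A := by
      refine aux_conn hpre ?_ ⟨x0, hx0B, hx0A⟩
      intro x hx hxA
      exact hT x hx (self_subset_thickening hr _ hxA)
    obtain ⟨e, he, het⟩ := exists_dir hn x0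
    have hn1 := het (R - r / 2 - ‖x0‖) (by linarith)
    have hmem : x0 + (R - r / 2 - ‖x0‖) • e ∈
        closedBall (0 : EuclideanSpace ℝ (Fin n)) (R - r / 2) := by
      rw [mem_closedBall_zero_iff, hn1]; linarith
    exact key _ (hsub hmem) (hT _ hmem) (by rw [hn1]; linarith) (by rw [hn1]; linarith)
  · left
    push Not at hT
    obtain ⟨w, hwB, hwT⟩ := hT
    have hne : (frontier A).Nonempty := by
      obtain ⟨y, hy, _⟩ := mem_thickening_iff.1 hwT
      exact ⟨y, hy⟩
    rw [mem_thickening_iff_infDist_lt hne] at hwT hx0T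
    obtain ⟨x, hxB, hx⟩ := hpre.intermediate_value hwB hx0B
      (continuous_infDist_pt (frontier A)).continuousOn ⟨hwT.le, not_lt.1 hx0T⟩
    obtain ⟨z, hz, hxz⟩ := isClosed_frontier.exists_infDist_eq_dist hne x
    have hxz' : dist x z = r := by rw [← hxz]; exact hx
    rw [mem_closedBall_zero_iff] at hxB
    rw [dist_comm, dist_eq_norm] at hxz'
    refine ⟨x + (1 / 4 : ℝ) • (z - x), subset_inter ?_ ?_⟩
    · intro p hp
      refine mem_thickening_iff.2 ⟨z, hz, ?_⟩
      have h1 : dist (x + (1 / 4 : ℝ) • (z - x)) z = 3 / 4 * r := by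
        have : x + (1 / 4 : ℝ) • (z - x) - z = (-(3 / 4) : ℝ) • (z - x) := by module
        rw [dist_eq_norm, this, norm_smul, hxz']
        norm_num
      have := dist_triangle p (x + (1 / 4 : ℝ) • (z - x)) z
      rw [mem_ball] at hp
      linarith
    · apply ball_shift
      rw [dist_zero_right]
      have := norm_add_le x ((1 / 4 : ℝ) • (z - x))
      rw [norm_smul, hxz'] at this
      norm_num at this ⊢
      linarith

lemma step {n : ℕ} (hn : 1 ≤ n) {Cbar c : ℝ} (hc0 : 0 < c) (hc1 : c ≤ 1)
    (hc : c * Cbar ≤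
      (1 / 4) ^ n * (volume (ball (0 : EuclideanSpace ℝ (Fin n)) 1)).toReal)
    {r R : ℝ} (hr : 0 < r) (hR : 0 < R)
    {E : Set (EuclideanSpace ℝ (Fin n))} (hE : MeasurableSet E)
    (hmin : IsMinimizerPerR n r E (ball 0 (R + 2 * r)))
    (hb : volume (E ∩ ball 0 R) ≤ ENNReal.ofReal (Cbar * r ^ n)) :
    ENNReal.ofReal (1 + c) * volume (E ∩ ball 0 R) ≤ volume (E ∩ ball 0 (R + 2 * r)) := by
  have hen := energy hn hr hR hE hmin
  have hgeom := geom hn (R := R) hr (densityOnePoints n E)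
  have hae := dens_ae hE
  set A := densityOnePoints n E
  have hgain : volume (A ∩ (ball 0 (R + 2 * r) \ ball 0 R)) =
      volume (E ∩ (ball 0 (R + 2 * r) \ ball 0 R)) :=
    measure_congr (hae.inter (ae_eq_refl _))
  have hAR : volume (A ∩ ball 0 R) = volume (E ∩ ball 0 R) :=
    measure_congr (hae.inter (ae_eq_refl _))
  have hball : ball (0 : EuclideanSpace ℝ (Fin n)) R ⊆ ball 0 (R + 2 * r) :=
    ball_subset_ball (by linarith)
  have hsplit := measure_inter_add_sdiff
    (μ := (volume : Measure (EuclideanSpace ℝ (Fin n))))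
    (E ∩ ball 0 (R + 2 * r)) (measurableSet_ball (x := 0) (ε := R))
  rw [inter_assoc, inter_eq_right.2 hball, inter_sdiff_assoc] at hsplit
  rw [← hsplit, ← hgain, ENNReal.ofReal_add zero_le_one hc0.le, ENNReal.ofReal_one, add_mul,
    one_mul]
  gcongr
  have hq : ∀ z : EuclideanSpace ℝ (Fin n),
      ENNReal.ofReal c * volume (E ∩ ball 0 R) ≤ volume (ball z (r / 4)) := by
    intro z
    refine (mul_le_mul_right hb _).trans ?_
    rw [Measure.addHaar_ball_of_pos _ _ (by positivity : (0 : ℝ) < r / 4),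
      finrank_euclideanSpace_fin, ← ENNReal.ofReal_toReal
        (measure_ball_lt_top (μ := volume) (x := (0 : EuclideanSpace ℝ (Fin n))) (r := 1)).ne,
      ← ENNReal.ofReal_mul hc0.le, ← ENNReal.ofReal_mul (by positivity)]
    apply ENNReal.ofReal_le_ofReal
    have := mul_le_mul_of_nonneg_left hc (pow_nonneg hr.le n)
    have h4 : (r / 4) ^ n = r ^ n * (1 / 4) ^ n := by rw [← mul_pow]; ring
    rw [h4]
    nlinarith
  rcases hgeom with h | ⟨z, h⟩ | ⟨z, h⟩
  · calc ENNReal.ofReal c * volume (E ∩ ball 0 R) ≤ 1 * volume (E ∩ ball 0 R) := by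
          gcongr
          simpa using ENNReal.ofReal_le_ofReal hc1
      _ = volume (A ∩ ball 0 R) := by rw [one_mul, hAR]
      _ ≤ _ := (measure_mono h).trans hen
  · exact (hq z).trans ((measure_mono h).trans hen)
  · exact (hq z).trans (measure_mono h)

/-- Exponential density growth below the threshold `rⁿ`: for every `n ≥ 1` and `C̄ > 0` there is
`c̃ > 0`, depending only on `n` and `C̄`, such that for every `r > 0`, every open `Ω`, every
measurable `E` minimizing `Per_r` in all open balls contained in `Ω`, every `R_o > 0` with
`B_{R_o} ⊆ Ω` and `ω_o := Lⁿ(E ∩ B_{R_o}) > 0`, and every `k ≥ 1` with `B_{R_o+2kr} ⊆ Ω`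
and `Lⁿ(E ∩ B_{R_o+2(k-1)r}) ≤ C̄ rⁿ`, one has `Lⁿ(E ∩ B_{R_o+2kr}) ≥ ω_o (1+c̃)^k`. -/
theorem exponential_density_growth (n : ℕ) (hn : 1 ≤ n) (Cbar : ℝ) (hCbar : 0 < Cbar) :
    ∃ ctil : ℝ, 0 < ctil ∧
      ∀ r : ℝ, 0 < r →
      ∀ Ω : Set (EuclideanSpace ℝ (Fin n)), IsOpen Ω →
      ∀ E : Set (EuclideanSpace ℝ (Fin n)), MeasurableSet E →
        (∀ (x : EuclideanSpace ℝ (Fin n)) (ρ : ℝ), 0 < ρ → ball x ρ ⊆ Ω →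
          IsMinimizerPerR n r E (ball x ρ)) →
      ∀ Ro : ℝ, 0 < Ro → ball (0 : EuclideanSpace ℝ (Fin n)) Ro ⊆ Ω →
      ∀ ωo : ℝ, 0 < ωo →
        volume (E ∩ ball (0 : EuclideanSpace ℝ (Fin n)) Ro) = ENNReal.ofReal ωo →
      ∀ k : ℕ, 1 ≤ k →
        ball (0 : EuclideanSpace ℝ (Fin n)) (Ro + 2 * k * r) ⊆ Ω →
        volume (E ∩ ball (0 : EuclideanSpace ℝ (Fin n)) (Ro + 2 * ((k : ℝ) - 1) * r)) ≤
          ENNReal.ofReal (Cbar * r ^ n) →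
        ENNReal.ofReal (ωo * (1 + ctil) ^ k) ≤
          volume (E ∩ ball (0 : EuclideanSpace ℝ (Fin n)) (Ro + 2 * k * r)) := by
  set ω : ℝ := (volume (ball (0 : EuclideanSpace ℝ (Fin n)) 1)).toReal with hω
  have hωpos : 0 < ω := ENNReal.toReal_pos (measure_ball_pos _ _ one_pos).ne'
    measure_ball_lt_top.ne
  refine ⟨min 1 ((1 / 4) ^ n * ω / Cbar), by positivity, ?_⟩
  set c := min 1 ((1 / 4) ^ n * ω / Cbar) with hcdef
  have hc0 : 0 < c := by positivity
  have hc1 : c ≤ 1 := min_le_left _ _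
  have hc : c * Cbar ≤ (1 / 4) ^ n * ω := by
    rw [← le_div_iff₀ hCbar]
    exact min_le_right _ _
  intro r hr Ω _ E hE hmin Ro hRo _ ωo hωo hvol k hk hkΩ hkvol
  have main : ∀ j : ℕ, j ≤ k → ENNReal.ofReal (ωo * (1 + c) ^ j) ≤
      volume (E ∩ ball (0 : EuclideanSpace ℝ (Fin n)) (Ro + 2 * j * r)) := by
    intro j
    induction j with
    | zero =>
      intro _
      simp [hvol]
    | succ j ih =>
      intro hj
      have hjk : (j : ℝ) + 1 ≤ k := by exact_mod_cast hj
      have hRj : (0 : ℝ) < Ro + 2 * j * r := by positivity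
      have heq : Ro + 2 * ((j + 1 : ℕ) : ℝ) * r = Ro + 2 * j * r + 2 * r := by
        push_cast; ring
      rw [heq]
      have hst := step hn hc0 hc1 hc hr hRj hE
        (hmin 0 _ (by positivity) ((ball_subset_ball (by nlinarith)).trans hkΩ))
        ((measure_mono (inter_subset_inter_right _ (ball_subset_ball (by nlinarith)))).trans hkvol)
      refine le_trans ?_ hst
      have h3 : ωo * (1 + c) ^ (j + 1) = (1 + c) * (ωo * (1 + c) ^ j) := by ring
      rw [h3, ENNReal.ofReal_mul (by positivity)]
      gcongr
      exact ih (by omega)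
  exact main k le_rfl
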